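/- arXiv:math/0002015 — 2 statements merged into one kernel-verified Lean document; each statement's English description precedes it below -/
import Mathlib

section
/- Let w = s_{i_L}⋯s_{i_1} be a reduced word in the Weyl group W of A whose letters i_1,…,i_L are the first L terms of ι, and let D_L be the subset of ℤ^∞_ι[λ] obtained from {0̄} by successively closing under the powers of f̃_{i_1}, …, f̃_{i_L} and removing 0. Then D_L = { x ∈ F(λ) : x_k = 0 for all k > L }. (This is the polyhedral description of the image of the crystal B_w(λ) of the Demazure module under the Kashiwara embedding Ψ_ι^{(λ)}.) -/
noncomputable section

namespace PaperNakashima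

variable {I : Type*} [DecidableEq I]

/-- `σ_k(x) = x_k + Σ_{j>k} a_{i_k i_j} x_j`. -/
def sig (A : I → I → ℤ) (ι : ℕ → I) (k : ℕ) (x : ℕ →₀ ℤ) : ℤ :=
  x k + ∑ j ∈ x.support.filter (fun j => k < j), A (ι k) (ι j) * x j

/-- `σ_0^{(i)}(x) = -λ_i + Σ_{j≥1} a_{i i_j} x_j`. -/
def sig0 (A : I → I → ℤ) (ι : ℕ → I) (lam : I → ℤ) (i : I) (x : ℕ →₀ ℤ) : ℤ :=
  -lam i + ∑ j ∈ x.support.filter (fun j => 1 ≤ j), A i (ι j) * x j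

/-- `σ^{(i)}(x) = max_{k ≥ 1, i_k = i} σ_k(x)`. -/
def sigMax (A : I → I → ℤ) (ι : ℕ → I) (i : I) (x : ℕ →₀ ℤ) : ℤ :=
  sSup ((fun k => sig A ι k x) '' {k | 1 ≤ k ∧ ι k = i})

/-- `M^{(i)}(x) = {k ≥ 1 : i_k = i, σ_k(x) = σ^{(i)}(x)}`. -/
def Mset (A : I → I → ℤ) (ι : ℕ → I) (i : I) (x : ℕ →₀ ℤ) : Set ℕ :=
  {k | 1 ≤ k ∧ ι k = i ∧ sig A ι k x = sigMax A ι i x}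

/-- The Kashiwara operator `f̃_i` on `ℤ^∞_ι[λ] ⊔ {0}`, with `none` playing the role of `0`. -/
def ftil (A : I → I → ℤ) (ι : ℕ → I) (lam : I → ℤ) (i : I) :
    Option (ℕ →₀ ℤ) → Option (ℕ →₀ ℤ)
  | none => none
  | some x =>
    if sig0 A ι lam i x < sigMax A ι i x then
      some (x + Finsupp.single (sInf (Mset A ι i x)) 1)
    else none

/-- The Kashiwara operator `ẽ_i` on `ℤ^∞_ι[λ] ⊔ {0}`. -/
def etil (A : I → I → ℤ) (ι : ℕ → I) (lam : I → ℤ) (i : I) :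
    Option (ℕ →₀ ℤ) → Option (ℕ →₀ ℤ)
  | none => none
  | some x =>
    if 0 < sigMax A ι i x ∧ sig0 A ι lam i x ≤ sigMax A ι i x then
      some (x - Finsupp.single (sSup (Mset A ι i x)) 1)
    else none

/-- `ε_i(x) = max(σ^{(i)}(x), σ_0^{(i)}(x))`. -/
def eps (A : I → I → ℤ) (ι : ℕ → I) (lam : I → ℤ) (i : I) (x : ℕ →₀ ℤ) : ℤ :=
  max (sigMax A ι i x) (sig0 A ι lam i x)

/-- `φ_i(x) = ε_i(x) - σ_0^{(i)}(x) = ⟨h_i, wt(x)⟩ + ε_i(x)`. -/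
def phi (A : I → I → ℤ) (ι : ℕ → I) (lam : I → ℤ) (i : I) (x : ℕ →₀ ℤ) : ℤ :=
  eps A ι lam i x - sig0 A ι lam i x

/-- `F(λ)`: the image of `B(λ)` under the Kashiwara embedding, i.e. all nonzero elements
obtained from the highest weight element `0̄` by applying Kashiwara operators `f̃`. -/
def FSet (A : I → I → ℤ) (ι : ℕ → I) (lam : I → ℤ) : Set (ℕ →₀ ℤ) :=
  {x | ∃ l : List I, List.foldl (fun y i => ftil A ι lam i y) (some 0) l = some x}

/-- The Demazure subsets `D_k`: `D_0 = {0̄}` and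
`D_k = { f̃_{i_k}^m(x) : m ≥ 0, x ∈ D_{k-1} } \ {0}`. -/
def Dem (A : I → I → ℤ) (ι : ℕ → I) (lam : I → ℤ) : ℕ → Set (ℕ →₀ ℤ)
  | 0 => {0}
  | (k+1) => {y | ∃ m : ℕ, ∃ x ∈ Dem A ι lam k,
      (ftil A ι lam (ι (k+1)))^[m] (some x) = some y}

/-- The Coxeter matrix entry attached to a generalized Cartan matrix:
`m_{ij} = 2, 3, 4, 6, ∞(=0)` according as `a_{ij} a_{ji} = 0, 1, 2, 3, ≥ 4`. -/
def coxEntry (A : I → I → ℤ) (i j : I) : ℕ :=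
  if i = j then 1
  else if A i j * A j i = 0 then 2
  else if A i j * A j i = 1 then 3
  else if A i j * A j i = 2 then 4
  else if A i j * A j i = 3 then 6
  else 0

/-- The Coxeter matrix of the Weyl group of a generalized Cartan matrix `A`. -/
def coxOf (A : I → I → ℤ) : CoxeterMatrix I where
  M := Matrix.of fun i j => coxEntry A i j
  isSymm := by
    ext i j
    by_cases h : i = j
    · simp [coxEntry, h]
    · simp only [Matrix.transpose_apply, Matrix.of_apply, coxEntry, if_neg h,
        if_neg (Ne.symm h), mul_comm (A i j) (A j i)]
  diagonal i := by simp [coxEntry]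
  off_diagonal i j h := by
    simp only [Matrix.of_apply, coxEntry, if_neg h]
    split_ifs <;> decide

/-- The word `i_L, i_{L-1}, …, i_1` (the first `L` letters of `ι`, read backwards). -/
def demWord (ι : ℕ → I) (L : ℕ) : List I :=
  (List.range L).map (fun k => ι (L - k))


/-- The running maximum `max(0, max {f s : s < t, col s = i})`. -/
def runMax (col : ℕ → I) (i : I) (f : ℕ → ℤ) : ℕ → ℤ
  | 0 => 0
  | t + 1 => if col t = i then max (runMax col i f t) (f t) else runMax col i f t

/-- Nested running maxima with alternating colours and Chebyshev-type coefficients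
`c, a c - c', …`. -/
def nest (col : ℕ → I) : ℕ → I → I → ℤ → ℤ → ℤ → ℤ → (ℕ → ℤ) → (ℕ → ℤ) → ℕ → ℤ
  | 0, _, _, _, _, _, _, _, _ => fun _ => 0
  | k + 1, i, j, a, b, c, c', p, q =>
    runMax col i (fun t => c * p t + nest col k j i b a (a * c - c') c q p t)

/-- The first `k` coefficients occurring in `nest` are nonnegative. -/
def CoeffNonneg : ℕ → ℤ → ℤ → ℤ → ℤ → Prop
  | 0, _, _, _, _ => True
  | k + 1, a, b, c, c' => 0 ≤ c ∧ CoeffNonneg k b a (a * c - c') c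

section RunMax

variable {col : ℕ → I} {i j : I}

lemma runMax_congr {f g : ℕ → ℤ} (h : ∀ t, col t = i → f t = g t) :
    runMax col i f = runMax col i g := by
  funext t
  induction t with
  | zero => rfl
  | succ t ih =>
    simp only [runMax, ih]
    split_ifs with hc
    · rw [h t hc]
    · rfl

lemma runMax_mono_fun {f g : ℕ → ℤ} (h : ∀ t, f t ≤ g t) (t : ℕ) :
    runMax col i f t ≤ runMax col i g t := by
  induction t with
  | zero => exact le_rfl
  | succ t ih =>
    simp only [runMax]
    split_ifs
    · exact max_le_max ih (h t)
    · exact ih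

lemma runMax_le_succ (f : ℕ → ℤ) (t : ℕ) : runMax col i f t ≤ runMax col i f (t + 1) := by
  simp only [runMax]
  split_ifs
  · exact le_max_left _ _
  · exact le_rfl

lemma runMax_mono (f : ℕ → ℤ) : Monotone (runMax col i f) :=
  monotone_nat_of_le_succ (runMax_le_succ f)

lemma runMax_nonneg (f : ℕ → ℤ) (t : ℕ) : 0 ≤ runMax col i f t :=
  runMax_mono f (Nat.zero_le t)

lemma le_runMax (f : ℕ → ℤ) {s t : ℕ} (hs : col s = i) (hst : s < t) :
    f s ≤ runMax col i f t := by
  refine le_trans ?_ (runMax_mono f (Nat.succ_le_of_lt hst))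
  simp only [runMax, if_pos hs]
  exact le_max_right _ _

lemma runMax_le (f : ℕ → ℤ) {t : ℕ} {M : ℤ} (hM : 0 ≤ M)
    (h : ∀ s < t, col s = i → f s ≤ M) : runMax col i f t ≤ M := by
  induction t with
  | zero => exact hM
  | succ t ih =>
    have := ih fun s hs => h s (by omega)
    simp only [runMax]
    split_ifs with hc
    · exact max_le this (h t (by omega) hc)
    · exact this

lemma runMax_attained (f : ℕ → ℤ) (t : ℕ) :
    runMax col i f t = 0 ∨ ∃ s < t, col s = i ∧ f s = runMax col i f t := by
  induction t with
  | zero => exact Or.inl rfl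
  | succ t ih =>
    simp only [runMax]
    split_ifs with hc
    · rcases le_total (runMax col i f t) (f t) with h | h
      · rw [max_eq_right h]
        exact Or.inr ⟨t, by omega, hc, rfl⟩
      · rw [max_eq_left h]
        rcases ih with h0 | ⟨s, hs, h1⟩
        · exact Or.inl h0
        · exact Or.inr ⟨s, by omega, h1⟩
    · rcases ih with h0 | ⟨s, hs, h1⟩
      · exact Or.inl h0
      · exact Or.inr ⟨s, by omega, h1⟩

lemma runMax_mul (f : ℕ → ℤ) {c : ℤ} (hc : 0 ≤ c) (t : ℕ) :
    runMax col i (fun s => c * f s) t = c * runMax col i f t := by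
  induction t with
  | zero => simp [runMax]
  | succ t ih =>
    simp only [runMax, ih]
    split_ifs
    · rw [mul_max_of_nonneg _ _ hc]
    · rfl

lemma runMax_zero (t : ℕ) : runMax col i (fun _ => 0) t = 0 := by
  induction t with
  | zero => rfl
  | succ t ih => simp [runMax, ih]

/-- The exchange identity behind the composition of two Pitman transforms. -/
lemma runMax_exchange (hij : i ≠ j) (p v : ℕ → ℤ) (t : ℕ) :
    runMax col i (fun s => p s - runMax col i p s - runMax col i p (s + 1)
        + runMax col j (fun r => v r + runMax col i p r) s) t + runMax col i p t
      = runMax col i (fun s => p s + runMax col j v s) t := by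
  suffices H : _ ∧ max (runMax col j (fun r => v r + runMax col i p r) t)
      (runMax col i (fun s => p s + runMax col j v s) t)
        = runMax col i p t + runMax col j v t from H.1
  induction t with
  | zero => simp [runMax]
  | succ t ih =>
    obtain ⟨h1, h2⟩ := ih
    simp only [runMax] at h1 h2 ⊢
    by_cases hi : col t = i
    · have hj : col t ≠ j := fun h => hij (hi.symm.trans h)
      simp only [hi, hij, if_true, if_false] at h1 h2 ⊢
      omega
    · by_cases hj : col t = j
      · have hji : j ≠ i := Ne.symm hij
        simp only [hj, hji, if_true, if_false] at h1 h2 ⊢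
        omega
      · simp only [hi, hj, if_false] at h1 h2 ⊢
        exact ⟨h1, h2⟩

end RunMax

section Nest

variable {col : ℕ → I}

lemma nest_le_succ (k : ℕ) : ∀ (i j : I) (a b c c' : ℤ) (p q : ℕ → ℤ) (t : ℕ),
    nest col k i j a b c c' p q t ≤ nest col (k + 1) i j a b c c' p q t := by
  induction k with
  | zero => intros; exact runMax_nonneg _ _
  | succ k ih =>
    intro i j a b c c' p q t
    rw [nest, nest]
    exact runMax_mono_fun (fun s => by have := ih j i b a (a * c - c') c q p s; linarith) t

lemma nest_mono {k l : ℕ} (h : k ≤ l) (i j : I) (a b c c' : ℤ) (p q : ℕ → ℤ) (t : ℕ) :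
    nest col k i j a b c c' p q t ≤ nest col l i j a b c c' p q t :=
  monotone_nat_of_le_succ (fun n => nest_le_succ n i j a b c c' p q t) h

lemma CoeffNonneg.mono {k : ℕ} : ∀ {l : ℕ} {a b c c' : ℤ}, k ≤ l → CoeffNonneg l a b c c' →
    CoeffNonneg k a b c c' := by
  induction k with
  | zero => intros; trivial
  | succ k ih =>
    intro l a b c c' hl h
    obtain ⟨l, rfl⟩ : ∃ m, l = m + 1 := ⟨l - 1, by omega⟩
    exact ⟨h.1, ih (by omega) h.2⟩

lemma coeffNonneg_of_four_le (k : ℕ) : ∀ {a b c c' : ℤ}, 0 ≤ a → 0 ≤ b → 4 ≤ a * b →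
    0 ≤ c → 2 * c' ≤ a * c → CoeffNonneg k a b c c' := by
  induction k with
  | zero => intros; trivial
  | succ k ih =>
    intro a b c c' ha hb hab hc hc'
    have hac : 0 ≤ a * c := mul_nonneg ha hc
    refine ⟨hc, ih hb ha (by linarith [mul_comm a b]) (by linarith) ?_⟩
    nlinarith [mul_le_mul_of_nonneg_left hc' hb, mul_nonneg (sub_nonneg.2 hab) hc]

lemma nest_pitman {i j : I} (hij : i ≠ j) (a b : ℤ) (p q : ℕ → ℤ) (r : ℕ) : ∀ c c' : ℤ,
    CoeffNonneg (2 * r + 1) a b c c' → ∀ t,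
    nest col (2 * r) i j a b c c'
        (fun t => p t - runMax col i p t - runMax col i p (t + 1))
        (fun t => q t + b * runMax col i p t) t + c * runMax col i p t
      = nest col (2 * r + 1) i j a b c c' p q t := by
  induction r with
  | zero =>
    intro c c' h t
    simp [nest, runMax_mul _ h.1]
  | succ r ih =>
    intro c c' h t
    have key := ih _ _ h.2.2
    have e1 : 2 * (r + 1) = 2 * r + 1 + 1 := by ring
    have hex := runMax_exchange (col := col) hij (fun s => c * p s)
      (fun s => (a * c - c') * q s
        + nest col (2 * r + 1) i j a b (b * (a * c - c') - c) (a * c - c') p q s) t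
    simp only [runMax_mul _ h.1] at hex
    rw [e1, nest, nest, nest, nest, ← hex]
    congr 1
    refine congrFun (congrArg _ (funext fun s => ?_)) t
    have e2 : (fun t => (a * c - c') * (q t + b * runMax col i p t)
        + nest col (2 * r) i j a b (b * (a * c - c') - c) (a * c - c')
          (fun t => p t - runMax col i p t - runMax col i p (t + 1))
          (fun t => q t + b * runMax col i p t) t)
      = fun r_1 => (a * c - c') * q r_1
        + nest col (2 * r + 1) i j a b (b * (a * c - c') - c) (a * c - c') p q r_1
        + c * runMax col i p r_1 := by
      funext u
      rw [← key u]
      ring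
    rw [e2]
    ring

/-- Total amounts subtracted from the two colours by `n` alternating Pitman transforms,
the first one being of colour `i`. -/
def pitTotal (col : ℕ → I) :
    ℕ → I → I → ℤ → ℤ → (ℕ → ℤ) → (ℕ → ℤ) → (ℕ → ℤ) × (ℕ → ℤ)
  | 0, _, _, _, _, _, _ => (fun _ => 0, fun _ => 0)
  | n + 1, i, j, a, b, p, q =>
    let r := pitTotal col n j i b a (fun t => q t + b * runMax col i p t)
      (fun t => p t - runMax col i p t - runMax col i p (t + 1))
    (fun t => runMax col i p t + r.2 t, r.1)

lemma pitTotal_congr (n : ℕ) : ∀ (i j : I) (a b : ℤ) {p q p' q' : ℕ → ℤ},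
    (∀ t, col t = i → p t = p' t) → (∀ t, col t = j → q t = q' t) →
    pitTotal col n i j a b p q = pitTotal col n i j a b p' q' := by
  induction n with
  | zero => intros; rfl
  | succ n ih =>
    intro i j a b p q p' q' hp hq
    have e := runMax_congr (col := col) hp
    simp only [pitTotal, e]
    rw [ih j i b a (q' := fun t => p' t - runMax col i p' t - runMax col i p' (t + 1))
      (p' := fun t => q' t + b * runMax col i p' t)]
    · intro t ht; simp only [hq t ht]
    · intro t ht; simp only [hp t ht]

lemma pitTotal_eq_nest (n : ℕ) : ∀ {i j : I} {a b : ℤ} (p q : ℕ → ℤ), i ≠ j →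
    CoeffNonneg n a b 1 0 → CoeffNonneg n b a 1 0 →
    pitTotal col n i j a b p q = (nest col (2 * ((n + 1) / 2) - 1) i j a b 1 0 p q,
      nest col (2 * (n / 2)) j i b a 1 0 q p) := by
  induction n with
  | zero => intros; rfl
  | succ n ih =>
    intro i j a b p q hij h1 h2
    simp only [pitTotal]
    rw [ih _ _ hij.symm (h2.mono (by omega)) (h1.mono (by omega))]
    refine Prod.ext (funext fun t => ?_) ?_
    · have := nest_pitman (col := col) hij a b p q (n / 2) 1 0 (h1.mono (by omega)) t
      have e : 2 * ((n + 1 + 1) / 2) - 1 = 2 * (n / 2) + 1 := by omega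
      simp only [e, ← this]
      ring
    · rcases Nat.eq_zero_or_pos n with rfl | hn
      · rfl
      · obtain ⟨s, hs⟩ : ∃ s, 2 * ((n + 1) / 2) = 2 * s + 1 + 1 := ⟨(n + 1) / 2 - 1, by omega⟩
        have e : 2 * ((n + 1) / 2) - 1 = 2 * s + 1 := by omega
        have h3 : CoeffNonneg (2 * s + 1 + 1) b a 1 0 := h2.mono (by omega)
        have key := nest_pitman (col := col) hij a b p q s _ _ h3.2
        simp only [e]
        rw [hs, nest, nest]
        refine congrArg _ (funext fun u => ?_)
        rw [← key u]
        ring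

lemma pitTotal_swap_of_lt_four {i j : I} {a b : ℤ} (p q : ℕ → ℤ) (hij : i ≠ j)
    (ha : 0 ≤ a) (hb : 0 ≤ b) (hz : a = 0 ↔ b = 0) (hab : a * b < 4) :
    ∃ n, 1 ≤ n ∧ pitTotal col n i j a b p q = (pitTotal col n j i b a q p).swap := by
  rcases eq_or_lt_of_le ha with h0 | h0
  · obtain rfl := h0.symm
    obtain rfl := hz.1 rfl
    refine ⟨2, by norm_num, ?_⟩
    rw [pitTotal_eq_nest 2 p q hij (by simp [CoeffNonneg]) (by simp [CoeffNonneg]),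
      pitTotal_eq_nest 2 q p hij.symm (by simp [CoeffNonneg]) (by simp [CoeffNonneg])]
    simp [nest, runMax_zero]
  · have hb0 : 0 < b := lt_of_le_of_ne hb fun h => h0.ne' (hz.2 h.symm)
    have ha4 : a < 4 := by nlinarith
    have hb4 : b < 4 := by nlinarith
    interval_cases a <;> interval_cases b <;> first
      | omega
      | (refine ⟨3, by norm_num, ?_⟩
         rw [pitTotal_eq_nest 3 p q hij (by simp [CoeffNonneg]) (by simp [CoeffNonneg]),
           pitTotal_eq_nest 3 q p hij.symm (by simp [CoeffNonneg]) (by simp [CoeffNonneg])]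
         simp [nest, runMax_zero]
         done)
      | (refine ⟨4, by norm_num, ?_⟩
         rw [pitTotal_eq_nest 4 p q hij (by simp [CoeffNonneg]) (by simp [CoeffNonneg]),
           pitTotal_eq_nest 4 q p hij.symm (by simp [CoeffNonneg]) (by simp [CoeffNonneg])]
         simp [nest, runMax_zero]
         done)
      | (refine ⟨6, by norm_num, ?_⟩
         rw [pitTotal_eq_nest 6 p q hij (by simp [CoeffNonneg]) (by simp [CoeffNonneg]),
           pitTotal_eq_nest 6 q p hij.symm (by simp [CoeffNonneg]) (by simp [CoeffNonneg])]
         simp [nest, runMax_zero])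

lemma pitTotal_interlace {i j : I} {a b : ℤ} (p q : ℕ → ℤ) (hij : i ≠ j)
    (ha : 0 ≤ a) (hb : 0 ≤ b) (hab : 4 ≤ a * b) (n t : ℕ) :
    (pitTotal col n i j a b p q).1 t ≤ (pitTotal col (n + 1) j i b a q p).2 t ∧
    (pitTotal col n i j a b p q).2 t ≤ (pitTotal col (n + 1) j i b a q p).1 t := by
  have h1 : ∀ k, CoeffNonneg k a b 1 0 := fun k =>
    coeffNonneg_of_four_le k ha hb hab zero_le_one (by linarith)
  have h2 : ∀ k, CoeffNonneg k b a 1 0 := fun k =>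
    coeffNonneg_of_four_le k hb ha (by linarith [mul_comm a b]) zero_le_one (by linarith)
  rw [pitTotal_eq_nest _ p q hij (h1 _) (h2 _), pitTotal_eq_nest _ q p hij.symm (h2 _) (h1 _)]
  exact ⟨nest_mono (by omega) _ _ _ _ _ _ _ _ _, nest_mono (by omega) _ _ _ _ _ _ _ _ _⟩

end Nest

section Path

variable {A : I → I → ℤ} {col : ℕ → I} {C : ℕ → ℤ}

/-- The function `σ` read along a path, i.e. from the tail of `x` towards its first entry. -/
def pathSig (A : I → I → ℤ) (col : ℕ → I) (C : ℕ → ℤ) (y : ℕ → ℤ) (t : ℕ) : ℤ :=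
  C t + y t + ∑ s ∈ Finset.range t, A (col t) (col s) * y s

/-- The Pitman transform of a path, i.e. the effect of the maximal power of `ẽ_i`. -/
def pitman (A : I → I → ℤ) (col : ℕ → I) (C : ℕ → ℤ) (i : I) (y : ℕ → ℤ) (t : ℕ) : ℤ :=
  y t - (runMax col i (pathSig A col C y) (t + 1) - runMax col i (pathSig A col C y) t)

/-- `n` alternating Pitman transforms, the first one being of colour `i`. -/
def pitChain (A : I → I → ℤ) (col : ℕ → I) (C : ℕ → ℤ) : ℕ → I → I → (ℕ → ℤ) → (ℕ → ℤ)
  | 0, _, _, y => y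
  | n + 1, i, j, y => pitChain A col C n j i (pitman A col C i y)

lemma pitman_le (i : I) (y : ℕ → ℤ) (t : ℕ) : pitman A col C i y t ≤ y t := by
  have := runMax_le_succ (col := col) (i := i) (pathSig A col C y) t
  simp only [pitman]
  linarith

lemma pitChain_succ_le (n : ℕ) : ∀ (i j : I) (y : ℕ → ℤ) (t : ℕ),
    pitChain A col C (n + 1) i j y t ≤ pitChain A col C n i j y t := by
  induction n with
  | zero => intro i j y t; exact pitman_le i y t
  | succ n ih => intro i j y t; exact ih j i (pitman A col C i y) t

lemma pitChain_antitone (i j : I) (y : ℕ → ℤ) (t : ℕ) :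
    Antitone fun n => pitChain A col C n i j y t :=
  antitone_nat_of_succ_le fun n => pitChain_succ_le n i j y t

lemma pathSig_pitman (i : I) (y : ℕ → ℤ) (t : ℕ) :
    pathSig A col C (pitman A col C i y) t = pathSig A col C y t
      - (runMax col i (pathSig A col C y) (t + 1) - runMax col i (pathSig A col C y) t)
      - A (col t) i * runMax col i (pathSig A col C y) t := by
  set R := runMax col i (pathSig A col C y) with hR
  have key : ∑ s ∈ Finset.range t, A (col t) (col s) * (R (s + 1) - R s) = A (col t) i * R t := by
    have h0 : R 0 = 0 := rfl
    rw [← sub_zero (R t), ← h0, ← Finset.sum_range_sub, Finset.mul_sum]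
    refine Finset.sum_congr rfl fun s _ => ?_
    by_cases hs : col s = i
    · rw [hs]
    · have : R (s + 1) = R s := by simp only [hR, runMax, if_neg hs]
      rw [this]; ring
  rw [pathSig, pathSig]
  simp only [pitman, mul_sub, Finset.sum_sub_distrib, ← hR] at key ⊢
  linarith

lemma pitChain_eq (hA : ∀ i, A i i = 2) (n : ℕ) : ∀ {i j : I}, i ≠ j → ∀ (y : ℕ → ℤ) (t : ℕ),
    pitChain A col C n i j y t = y t
      - ((pitTotal col n i j (-A i j) (-A j i) (pathSig A col C y) (pathSig A col C y)).1 (t + 1)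
        - (pitTotal col n i j (-A i j) (-A j i) (pathSig A col C y) (pathSig A col C y)).1 t)
      - ((pitTotal col n i j (-A i j) (-A j i) (pathSig A col C y) (pathSig A col C y)).2 (t + 1)
        - (pitTotal col n i j (-A i j) (-A j i) (pathSig A col C y) (pathSig A col C y)).2 t) := by
  induction n with
  | zero => intros; simp [pitChain, pitTotal]
  | succ n ih =>
    intro i j hij y t
    have e := pitTotal_congr (col := col) n j i (-A j i) (-A i j)
      (p := pathSig A col C (pitman A col C i y)) (q := pathSig A col C (pitman A col C i y))
      (p' := fun t => pathSig A col C y t + -A j i * runMax col i (pathSig A col C y) t)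
      (q' := fun t => pathSig A col C y t - runMax col i (pathSig A col C y) t
        - runMax col i (pathSig A col C y) (t + 1))
      (fun t ht => by
        rw [pathSig_pitman, ht]
        simp only [runMax, ht, if_neg (Ne.symm hij)]
        ring)
      (fun t ht => by rw [pathSig_pitman, ht, hA]; ring)
    rw [pitChain, ih hij.symm, e]
    simp only [pitTotal, pitman]
    ring

lemma pitTotal_zero_time (n : ℕ) : ∀ (i j : I) (a b : ℤ) (p q : ℕ → ℤ),
    (pitTotal col n i j a b p q).1 0 = 0 ∧ (pitTotal col n i j a b p q).2 0 = 0 := by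
  induction n with
  | zero => intros; exact ⟨rfl, rfl⟩
  | succ n ih =>
    intro i j a b p q
    simp [pitTotal, ih, runMax]

lemma pitTotal_succ_time (n : ℕ) : ∀ (i j : I) (a b : ℤ) (p q : ℕ → ℤ) (t : ℕ),
    (col t ≠ i → (pitTotal col n i j a b p q).1 (t + 1) = (pitTotal col n i j a b p q).1 t) ∧
    (col t ≠ j → (pitTotal col n i j a b p q).2 (t + 1) = (pitTotal col n i j a b p q).2 t) := by
  induction n with
  | zero => intros; exact ⟨fun _ => rfl, fun _ => rfl⟩
  | succ n ih =>
    intro i j a b p q t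
    refine ⟨fun h => ?_, fun h => (ih _ _ _ _ _ _ t).1 h⟩
    simp only [pitTotal, runMax, if_neg h]
    rw [(ih _ _ _ _ _ _ t).2 h]

lemma pitTotal_eq_of_pitChain_eq (hA : ∀ i, A i i = 2) {i j : I} (hij : i ≠ j) {n m : ℕ}
    {y : ℕ → ℤ} (h : pitChain A col C n i j y = pitChain A col C m i j y) (t : ℕ) :
    (pitTotal col n i j (-A i j) (-A j i) (pathSig A col C y) (pathSig A col C y)).1 t
      = (pitTotal col m i j (-A i j) (-A j i) (pathSig A col C y) (pathSig A col C y)).1 t ∧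
    (pitTotal col n i j (-A i j) (-A j i) (pathSig A col C y) (pathSig A col C y)).2 t
      = (pitTotal col m i j (-A i j) (-A j i) (pathSig A col C y) (pathSig A col C y)).2 t := by
  induction t with
  | zero => simp [pitTotal_zero_time]
  | succ t ih =>
    have e := congrFun h t
    rw [pitChain_eq hA n hij, pitChain_eq hA m hij] at e
    have h1 := pitTotal_succ_time (col := col) n i j (-A i j) (-A j i)
      (pathSig A col C y) (pathSig A col C y) t
    have h2 := pitTotal_succ_time (col := col) m i j (-A i j) (-A j i)
      (pathSig A col C y) (pathSig A col C y) t
    by_cases hi : col t = i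
    · have hj : col t ≠ j := fun h => hij (hi.symm.trans h)
      have := h1.2 hj
      have := h2.2 hj
      constructor <;> linarith [ih.1, ih.2]
    · have := h1.1 hi
      have := h2.1 hi
      constructor <;> linarith [ih.1, ih.2]

lemma pitChain_confluent (hA : ∀ i, A i i = 2) (hAoff : ∀ i j, i ≠ j → A i j ≤ 0)
    (hAzero : ∀ i j, A i j = 0 ↔ A j i = 0) {i j : I} (hij : i ≠ j) (y : ℕ → ℤ)
    (hstab : ∃ n, 1 ≤ n ∧ pitChain A col C n j i y = pitChain A col C (n + 2) j i y) :
    ∃ n m, 1 ≤ n ∧ 1 ≤ m ∧ pitChain A col C n i j y = pitChain A col C m j i y := by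
  have ha : 0 ≤ -A i j := by linarith [hAoff i j hij]
  have hb : 0 ≤ -A j i := by linarith [hAoff j i hij.symm]
  rcases lt_or_ge (-A i j * -A j i) 4 with h4 | h4
  · obtain ⟨n, hn, e⟩ := pitTotal_swap_of_lt_four (col := col) (pathSig A col C y)
      (pathSig A col C y) hij ha hb (by simp [hAzero i j]) h4
    refine ⟨n, n, hn, hn, funext fun t => ?_⟩
    rw [pitChain_eq hA n hij, pitChain_eq hA n hij.symm, e]
    simp only [Prod.fst_swap, Prod.snd_swap]
    ring
  · obtain ⟨n, hn, e⟩ := hstab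
    refine ⟨n + 1, n, by omega, hn, funext fun t => ?_⟩
    rw [pitChain_eq hA _ hij, pitChain_eq hA n hij.symm]
    have e1 := pitTotal_eq_of_pitChain_eq hA hij.symm e
    have h1 := pitTotal_interlace (col := col) (pathSig A col C y) (pathSig A col C y)
      hij.symm hb ha (by linarith [mul_comm (A i j) (A j i)]) n
    have h2 := pitTotal_interlace (col := col) (pathSig A col C y) (pathSig A col C y)
      hij ha hb h4 (n + 1)
    linarith [e1 t, e1 (t + 1), h1 t, h1 (t + 1), h2 t, h2 (t + 1),
      (e1 t).1, (e1 t).2, (e1 (t + 1)).1, (e1 (t + 1)).2, (h1 t).1, (h1 t).2, (h1 (t + 1)).1,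
      (h1 (t + 1)).2, (h2 t).1, (h2 t).2, (h2 (t + 1)).1, (h2 (t + 1)).2]

lemma pitman_eq_of_add_one (hA : ∀ i, A i i = 2) {i : I} {s : ℕ} (hs : col s = i)
    (y : ℕ → ℤ) (h0 : 0 ≤ pathSig A col C y s)
    (hle : ∀ t < s, col t = i → pathSig A col C y t ≤ pathSig A col C y s)
    (hlt : ∀ t, s < t → col t = i → pathSig A col C y t < pathSig A col C y s) :
    pitman A col C i (fun t => y t + if t = s then 1 else 0) = pitman A col C i y := by
  set y' : ℕ → ℤ := fun t => y t + if t = s then 1 else 0 with hy'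
  have hsig : ∀ t, pathSig A col C y' t = pathSig A col C y t + (if t = s then 1 else 0)
      + if s < t then A (col t) i else 0 := by
    intro t
    simp only [pathSig, hy', mul_add, Finset.sum_add_distrib, mul_ite, mul_one, mul_zero,
      Finset.sum_ite_eq', Finset.mem_range, hs]
    ring
  set R := runMax col i (pathSig A col C y)
  set R' := runMax col i (pathSig A col C y')
  have hlow : ∀ t ≤ s, R' t = R t := by
    intro t
    induction t with
    | zero => intro _; rfl
    | succ t ih =>
      intro ht
      have e : pathSig A col C y' t = pathSig A col C y t := by
        rw [hsig, if_neg (by omega), if_neg (by omega)]; ring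
      simp only [R, R', runMax, e] at ih ⊢
      rw [ih (by omega)]
  have hhigh : ∀ t, s < t → R t = pathSig A col C y s ∧ R' t = pathSig A col C y s + 1 := by
    intro t ht
    constructor
    · refine le_antisymm (runMax_le _ h0 fun u _ hu => ?_) (le_runMax _ hs ht)
      rcases lt_trichotomy u s with h | rfl | h
      · exact hle u h hu
      · exact le_rfl
      · exact (hlt u h hu).le
    · have es : pathSig A col C y' s = pathSig A col C y s + 1 := by
        rw [hsig, if_pos rfl, if_neg (by omega)]; ring
      refine le_antisymm (runMax_le _ (by omega) fun u _ hu => ?_)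
        (es ▸ le_runMax _ hs ht)
      rcases lt_trichotomy u s with h | rfl | h
      · have := hle u h hu
        rw [hsig, if_neg (by omega), if_neg (by omega)]; omega
      · exact es.le
      · have := hlt u h hu
        rw [hsig, if_neg (by omega), if_pos h, hu, hA]; omega
  funext t
  have e1 : pitman A col C i y' t = y' t - (R' (t + 1) - R' t) := rfl
  have e2 : pitman A col C i y t = y t - (R (t + 1) - R t) := rfl
  rw [e1, e2]
  rcases lt_trichotomy t s with h | rfl | h
  · rw [hlow t h.le, hlow (t + 1) h]
    simp [hy', h.ne]
  · rw [hlow t le_rfl, (hhigh (t + 1) (by omega)).1, (hhigh (t + 1) (by omega)).2]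
    simp only [hy', if_pos]
    ring
  · rw [(hhigh t h).1, (hhigh t h).2, (hhigh (t + 1) (by omega)).1, (hhigh (t + 1) (by omega)).2]
    simp [hy', h.ne']

end Path

set_option linter.unusedSectionVars false

section Bridge

variable {A : I → I → ℤ} {ι : ℕ → I} {lam : I → ℤ} {N : ℕ}

/-- The sequence `x` lives in the positions `1, …, N`. -/
def SuppIn (N : ℕ) (x : ℕ →₀ ℤ) : Prop := ∀ k, x k ≠ 0 → 1 ≤ k ∧ k ≤ N

/-- Colours of the time-reversed path; from time `N` on they run through `ι` again, providing
one virtual position for each `σ_0^{(i)}`. -/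
def timeCol (ι : ℕ → I) (N t : ℕ) : I := if t < N then ι (N - t) else ι (t - N + 1)

/-- The shifts of the time-reversed path: `-λ_i` at the virtual positions. -/
def timeShift (ι : ℕ → I) (lam : I → ℤ) (N t : ℕ) : ℤ := if t < N then 0 else -lam (timeCol ι N t)

/-- The time-reversed path of `x`. -/
def timePath (N : ℕ) (x : ℕ →₀ ℤ) (t : ℕ) : ℤ := if t < N then x (N - t) else 0

lemma timePath_injective {x y : ℕ →₀ ℤ} (hx : SuppIn N x) (hy : SuppIn N y)
    (h : timePath N x = timePath N y) : x = y := by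
  ext k
  by_cases hk : 1 ≤ k ∧ k ≤ N
  · have := congrFun h (N - k)
    simp only [timePath, if_pos (show N - k < N by omega)] at this
    rwa [show N - (N - k) = k by omega] at this
  · rw [not_imp_comm.1 (hx k) hk, not_imp_comm.1 (hy k) hk]

lemma exists_timePath_eq {f : ℕ → ℤ} (hf : ∀ t, N ≤ t → f t = 0) :
    ∃ x, SuppIn N x ∧ timePath N x = f := by
  refine ⟨Finsupp.onFinset (Finset.Icc 1 N) (fun k => if 1 ≤ k ∧ k ≤ N then f (N - k) else 0)
    (fun k hk => ?_), fun k hk => ?_, funext fun t => ?_⟩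
  · by_contra h
    rw [Finset.mem_Icc] at h
    exact hk (if_neg h)
  · by_contra h
    exact hk (by simp [Finsupp.onFinset_apply, h])
  · by_cases ht : t < N
    · simp only [timePath, if_pos ht, Finsupp.onFinset_apply]
      rw [if_pos (by omega), show N - (N - t) = t by omega]
    · simp only [timePath, if_neg ht]
      rw [hf t (by omega)]

lemma sum_support_filter_eq {x : ℕ →₀ ℤ} (hx : SuppIn N x) (g : ℕ → ℤ) {t : ℕ} (ht : t ≤ N) :
    ∑ j ∈ x.support.filter (fun j => N - t < j), g j * x j
      = ∑ s ∈ Finset.range t, g (N - s) * x (N - s) := by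
  have h1 : ∑ j ∈ x.support.filter (fun j => N - t < j), g j * x j
      = ∑ j ∈ Finset.Ioc (N - t) N, g j * x j := by
    refine Finset.sum_subset (fun j hj => ?_) fun j hj hj' => ?_
    · rw [Finset.mem_filter, Finsupp.mem_support_iff] at hj
      exact Finset.mem_Ioc.2 ⟨hj.2, (hx j hj.1).2⟩
    · rw [Finset.mem_filter, Finsupp.mem_support_iff, not_and'] at hj'
      rw [not_not.1 (hj' (Finset.mem_Ioc.1 hj).1), mul_zero]
  rw [h1]
  refine Finset.sum_nbij' (fun j => N - j) (fun s => N - s) ?_ ?_ ?_ ?_ ?_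
  · intro j hj; rw [Finset.mem_Ioc] at hj; rw [Finset.mem_range]; omega
  · intro s hs; rw [Finset.mem_range] at hs; rw [Finset.mem_Ioc]; omega
  · intro j hj; rw [Finset.mem_Ioc] at hj; show N - (N - j) = j; omega
  · intro s hs; rw [Finset.mem_range] at hs; show N - (N - s) = s; omega
  · intro j hj; rw [Finset.mem_Ioc] at hj; rw [show N - (N - j) = j by omega]

lemma timeCol_sub {k : ℕ} (h1 : 1 ≤ k) (h2 : k ≤ N) : timeCol ι N (N - k) = ι k := by
  rw [timeCol, if_pos (by omega), show N - (N - k) = k by omega]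

lemma sum_timePath {x : ℕ →₀ ℤ} (i : I) {t : ℕ} (ht : t ≤ N) :
    ∑ s ∈ Finset.range t, A i (timeCol ι N s) * timePath N x s
      = ∑ s ∈ Finset.range t, A i (ι (N - s)) * x (N - s) := by
  refine Finset.sum_congr rfl fun s hs => ?_
  rw [Finset.mem_range] at hs
  rw [timeCol, timePath, if_pos (by omega), if_pos (by omega)]

lemma pathSig_timePath {x : ℕ →₀ ℤ} (hx : SuppIn N x) {t : ℕ} (ht : t < N) :
    pathSig A (timeCol ι N) (timeShift ι lam N) (timePath N x) t = sig A ι (N - t) x := by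
  rw [pathSig, sig, sum_timePath _ ht.le,
    sum_support_filter_eq hx (fun j => A (ι (N - t)) (ι j)) ht.le, timeShift, timeCol,
    timePath, if_pos ht, if_pos ht, if_pos ht]
  ring

lemma pathSig_timePath_virtual {x : ℕ →₀ ℤ} (hx : SuppIn N x) {t : ℕ} (ht : N ≤ t) :
    pathSig A (timeCol ι N) (timeShift ι lam N) (timePath N x) t
      = sig0 A ι lam (timeCol ι N t) x := by
  have h0 := sum_support_filter_eq hx (fun j => A (timeCol ι N t) (ι j)) le_rfl
  rw [Nat.sub_self] at h0
  have h1 : ∑ s ∈ Finset.range t, A (timeCol ι N t) (timeCol ι N s) * timePath N x s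
      = ∑ s ∈ Finset.range N, A (timeCol ι N t) (timeCol ι N s) * timePath N x s := by
    refine (Finset.sum_subset (Finset.range_subset_range.2 ht) fun s _ hs => ?_).symm
    rw [timePath, if_neg (by simpa using hs), mul_zero]
  rw [pathSig, h1, sum_timePath _ le_rfl, ← h0, sig0, timeShift, timePath, if_neg (by omega),
    if_neg (by omega)]
  simp only [Nat.succ_le_iff, add_zero]

lemma sig_eq_zero {x : ℕ →₀ ℤ} (hx : SuppIn N x) {k : ℕ} (hk : N < k) : sig A ι k x = 0 := by
  have h0 : x k = 0 := by
    by_contra h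
    have := (hx k h).2
    omega
  rw [sig, h0, zero_add]
  refine Finset.sum_eq_zero fun j hj => ?_
  rw [Finset.mem_filter, Finsupp.mem_support_iff] at hj
  have := (hx j hj.1).2
  omega

lemma sigMax_isGreatest (hι : ∀ i : I, {k : ℕ | 1 ≤ k ∧ ι k = i}.Infinite) {x : ℕ →₀ ℤ}
    (hx : SuppIn N x) (i : I) :
    IsGreatest ((fun k => sig A ι k x) '' {k | 1 ≤ k ∧ ι k = i})
      (runMax (timeCol ι N) i
        (pathSig A (timeCol ι N) (timeShift ι lam N) (timePath N x)) N) := by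
  constructor
  · rcases runMax_attained (col := timeCol ι N) (i := i)
      (pathSig A (timeCol ι N) (timeShift ι lam N) (timePath N x)) N with h | ⟨s, hs, hc, h⟩
    · obtain ⟨k, hk, hkN⟩ := (hι i).exists_gt N
      exact ⟨k, hk, (sig_eq_zero hx hkN).trans h.symm⟩
    · rw [pathSig_timePath hx hs] at h
      rw [timeCol, if_pos hs] at hc
      exact ⟨N - s, ⟨by omega, hc⟩, h⟩
  · rintro _ ⟨k, ⟨hk, hki⟩, rfl⟩
    rcases lt_or_ge N k with h | h
    · simp only [sig_eq_zero hx h]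
      exact runMax_nonneg _ _
    · have e := pathSig_timePath (A := A) (ι := ι) (lam := lam) hx (show N - k < N by omega)
      rw [show N - (N - k) = k by omega] at e
      simp only [← e]
      exact le_runMax _ (by rw [timeCol_sub hk h, hki]) (by omega)

lemma sigMax_eq_runMax (hι : ∀ i : I, {k : ℕ | 1 ≤ k ∧ ι k = i}.Infinite) {x : ℕ →₀ ℤ}
    (hx : SuppIn N x) (i : I) :
    sigMax A ι i x = runMax (timeCol ι N) i
      (pathSig A (timeCol ι N) (timeShift ι lam N) (timePath N x)) N :=
  (sigMax_isGreatest hι hx i).csSup_eq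

lemma exists_suppIn {x : ℕ →₀ ℤ} (h0 : x 0 = 0) : ∃ N, SuppIn N x := by
  refine ⟨x.support.sup id, fun k hk => ⟨?_, ?_⟩⟩
  · rcases Nat.eq_zero_or_pos k with rfl | h
    · exact absurd h0 hk
    · exact h
  · exact Finset.le_sup (f := id) (Finsupp.mem_support_iff.2 hk)

lemma sigMax_spec (hι : ∀ i : I, {k : ℕ | 1 ≤ k ∧ ι k = i}.Infinite) {x : ℕ →₀ ℤ}
    (hx : x 0 = 0) (i : I) :
    IsGreatest ((fun k => sig A ι k x) '' {k | 1 ≤ k ∧ ι k = i}) (sigMax A ι i x) := by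
  obtain ⟨N, hN⟩ := exists_suppIn hx
  rw [sigMax_eq_runMax (lam := fun _ => 0) hι hN]
  exact sigMax_isGreatest hι hN i

lemma sigMax_nonneg (hι : ∀ i : I, {k : ℕ | 1 ≤ k ∧ ι k = i}.Infinite) {x : ℕ →₀ ℤ}
    (hx : x 0 = 0) (i : I) : 0 ≤ sigMax A ι i x := by
  obtain ⟨N, hN⟩ := exists_suppIn hx
  rw [sigMax_eq_runMax (lam := fun _ => 0) hι hN]
  exact runMax_nonneg _ _

lemma sig_le_sigMax (hι : ∀ i : I, {k : ℕ | 1 ≤ k ∧ ι k = i}.Infinite) {x : ℕ →₀ ℤ}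
    (hx : x 0 = 0) {i : I} {k : ℕ} (hk : 1 ≤ k) (hki : ι k = i) :
    sig A ι k x ≤ sigMax A ι i x :=
  (sigMax_spec hι hx i).2 ⟨k, ⟨hk, hki⟩, rfl⟩

lemma sig_add_single (x : ℕ →₀ ℤ) (k l : ℕ) :
    sig A ι l (x + Finsupp.single k 1) = sig A ι l x + (if l = k then 1 else 0)
      + if l < k then A (ι l) (ι k) else 0 := by
  have h : ∀ z : ℕ →₀ ℤ, sig A ι l z
      = z l + z.sum fun j v => if l < j then A (ι l) (ι j) * v else 0 := by
    intro z
    rw [sig, Finset.sum_filter]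
    rfl
  rw [h, h, Finsupp.sum_add_index' (by simp) (by intros; split_ifs <;> ring),
    Finsupp.sum_single_index (by simp), Finsupp.add_apply, Finsupp.single_apply]
  simp only [mul_one, eq_comm (a := k)]
  ring

lemma sig0_add_single (x : ℕ →₀ ℤ) {k : ℕ} (hk : 1 ≤ k) (i : I) :
    sig0 A ι lam i (x + Finsupp.single k 1) = sig0 A ι lam i x + A i (ι k) := by
  have h : ∀ z : ℕ →₀ ℤ, sig0 A ι lam i z
      = -lam i + z.sum fun j v => if 1 ≤ j then A i (ι j) * v else 0 := by
    intro z
    rw [sig0, Finset.sum_filter]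
    rfl
  rw [h, h, Finsupp.sum_add_index' (by simp) (by intros; split_ifs <;> ring),
    Finsupp.sum_single_index (by simp), if_pos hk]
  ring

/-- `k` is the position on which `f̃_i` acts. -/
structure IsFirstMax (A : I → I → ℤ) (ι : ℕ → I) (i : I) (x : ℕ →₀ ℤ) (k : ℕ) : Prop where
  one_le : 1 ≤ k
  col : ι k = i
  le : ∀ l, 1 ≤ l → ι l = i → sig A ι l x ≤ sig A ι k x
  lt : ∀ l, 1 ≤ l → l < k → ι l = i → sig A ι l x < sig A ι k x

lemma IsFirstMax.sigMax_eq {i : I} {x : ℕ →₀ ℤ} {k : ℕ} (h : IsFirstMax A ι i x k) :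
    sigMax A ι i x = sig A ι k x := by
  refine IsGreatest.csSup_eq ⟨⟨k, ⟨h.one_le, h.col⟩, rfl⟩, ?_⟩
  rintro _ ⟨l, ⟨hl, hli⟩, rfl⟩
  exact h.le l hl hli

lemma ftil_eq_some_iff (hι : ∀ i : I, {k : ℕ | 1 ≤ k ∧ ι k = i}.Infinite) {x y : ℕ →₀ ℤ}
    (hx : x 0 = 0) (i : I) :
    ftil A ι lam i (some x) = some y ↔ sig0 A ι lam i x < sigMax A ι i x ∧
      ∃ k, IsFirstMax A ι i x k ∧ y = x + Finsupp.single k 1 := by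
  have hne : (Mset A ι i x).Nonempty := by
    obtain ⟨k, ⟨hk, hki⟩, h⟩ := (sigMax_spec (A := A) hι hx i).1
    exact ⟨k, hk, hki, h⟩
  simp only [ftil]
  constructor
  · intro h
    split_ifs at h with h0
    refine ⟨h0, _, ?_, (Option.some.inj h).symm⟩
    obtain ⟨h1, h2, h3⟩ := Nat.sInf_mem hne
    refine ⟨h1, h2, fun l hl hli => h3 ▸ sig_le_sigMax hι hx hl hli, fun l hl hlt hli => ?_⟩
    refine lt_of_le_of_ne (h3 ▸ sig_le_sigMax hι hx hl hli) fun e => ?_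
    exact Nat.notMem_of_lt_sInf hlt ⟨hl, hli, e.trans h3⟩
  · rintro ⟨h0, k, hk, rfl⟩
    rw [if_pos h0]
    have hkM : k ∈ Mset A ι i x := ⟨hk.one_le, hk.col, hk.sigMax_eq.symm⟩
    have : sInf (Mset A ι i x) = k := by
      refine le_antisymm (Nat.sInf_le hkM) (not_lt.1 fun hlt => ?_)
      obtain ⟨h1, h2, h3⟩ := Nat.sInf_mem hne
      have := hk.lt _ h1 hlt h2
      rw [h3, hk.sigMax_eq] at this
      exact lt_irrefl _ this
    rw [this]

end Bridge

section Embedding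

variable {A : I → I → ℤ} {ι : ℕ → I} {lam : I → ℤ} {N : ℕ}

lemma SuppIn.apply_zero {x : ℕ →₀ ℤ} (h : SuppIn N x) : x 0 = 0 := by
  by_contra h0
  have := (h 0 h0).1
  omega

lemma zero_mem_FSet : (0 : ℕ →₀ ℤ) ∈ FSet A ι lam := ⟨[], rfl⟩

lemma FSet_of_ftil {x y : ℕ →₀ ℤ} {i : I} (hx : x ∈ FSet A ι lam)
    (h : ftil A ι lam i (some x) = some y) : y ∈ FSet A ι lam := by
  obtain ⟨l, hl⟩ := hx
  exact ⟨l ++ [i], by rw [List.foldl_append, hl]; exact h⟩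

lemma FSet_induction {P : (ℕ →₀ ℤ) → Prop} (h0 : P 0)
    (hs : ∀ x y i, x ∈ FSet A ι lam → P x → ftil A ι lam i (some x) = some y → P y) :
    ∀ x ∈ FSet A ι lam, P x := by
  rintro x ⟨l, hl⟩
  induction l using List.reverseRecOn generalizing x with
  | nil => exact Option.some.inj hl ▸ h0
  | append_singleton l i ih =>
    rw [List.foldl_append] at hl
    cases h : List.foldl (fun y i => ftil A ι lam i y) (some 0) l with
    | none => rw [h] at hl; exact absurd hl (by simp [ftil])
    | some y =>
      rw [h] at hl
      exact hs y x i ⟨l, h⟩ (ih y h) hl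

lemma FSet_nonneg (hι : ∀ i : I, {k : ℕ | 1 ≤ k ∧ ι k = i}.Infinite) :
    ∀ x ∈ FSet A ι lam, x 0 = 0 ∧ ∀ k, 0 ≤ x k := by
  refine FSet_induction ⟨rfl, fun k => le_rfl⟩ ?_
  rintro x y i - ⟨h0, h⟩ hf
  obtain ⟨-, k, hk, rfl⟩ := (ftil_eq_some_iff hι h0 i).1 hf
  refine ⟨?_, fun l => ?_⟩
  · have := hk.one_le
    simp [h0, Finsupp.single_apply]
    omega
  · have := h l
    simp only [Finsupp.add_apply, Finsupp.single_apply]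
    split_ifs <;> omega

lemma degree_nonneg {x : ℕ →₀ ℤ} (h : ∀ k, 0 ≤ x k) : 0 ≤ x.degree := by
  rw [Finsupp.degree_apply]
  exact Finset.sum_nonneg fun k _ => h k

lemma degree_ftil (hι : ∀ i : I, {k : ℕ | 1 ≤ k ∧ ι k = i}.Infinite) {x y : ℕ →₀ ℤ} {i : I}
    (hx : x 0 = 0) (h : ftil A ι lam i (some x) = some y) : y.degree = x.degree + 1 := by
  obtain ⟨-, k, -, rfl⟩ := (ftil_eq_some_iff hι hx i).1 h
  rw [map_add, Finsupp.degree_single]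

lemma le_ftil (hι : ∀ i : I, {k : ℕ | 1 ≤ k ∧ ι k = i}.Infinite) {x y : ℕ →₀ ℤ} {i : I}
    (hx : x 0 = 0) (h : ftil A ι lam i (some x) = some y) (k : ℕ) : x k ≤ y k := by
  obtain ⟨-, k, -, rfl⟩ := (ftil_eq_some_iff hι hx i).1 h
  simp only [Finsupp.add_apply, Finsupp.single_apply]
  split_ifs <;> omega

lemma SuppIn.of_le {x y : ℕ →₀ ℤ} (hy : SuppIn N y) (hx : ∀ k, 0 ≤ x k) (h : ∀ k, x k ≤ y k) :
    SuppIn N x := fun k hk => hy k (by have := hx k; have := h k; omega)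

lemma pitman_eq_of_ftil (hA : ∀ i, A i i = 2)
    (hι : ∀ i : I, {k : ℕ | 1 ≤ k ∧ ι k = i}.Infinite) {x y : ℕ →₀ ℤ} {i : I}
    (hx : SuppIn N x) (hy : SuppIn N y) (h : ftil A ι lam i (some x) = some y) :
    pitman A (timeCol ι N) (timeShift ι lam N) i (timePath N y)
      = pitman A (timeCol ι N) (timeShift ι lam N) i (timePath N x) := by
  obtain ⟨h0, k, hk, rfl⟩ := (ftil_eq_some_iff hι hx.apply_zero i).1 h
  have hk1 := hk.one_le
  have hkN : k ≤ N := by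
    by_contra hlt
    have hxk : x k = 0 := by
      by_contra hne
      exact hlt (hx k hne).2
    exact hlt (hy k (by simp [hxk])).2
  have e : timePath N (x + Finsupp.single k 1)
      = fun t => timePath N x t + if t = N - k then 1 else 0 := by
    funext t
    by_cases ht : t < N
    · simp only [timePath, if_pos ht, Finsupp.add_apply, Finsupp.single_apply]
      congr 1
      exact if_congr (by omega) rfl rfl
    · simp only [timePath, if_neg ht]
      rw [if_neg (by omega), add_zero]
  have es : pathSig A (timeCol ι N) (timeShift ι lam N) (timePath N x) (N - k)
      = sigMax A ι i x := by
    rw [pathSig_timePath hx (by omega), show N - (N - k) = k by omega, hk.sigMax_eq]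
  rw [e]
  refine pitman_eq_of_add_one hA ((timeCol_sub hk1 hkN).trans hk.col) _ ?_ ?_ ?_
  · rw [es]
    exact sigMax_nonneg hι hx.apply_zero i
  · intro t ht hc
    rw [es, pathSig_timePath hx (by omega)]
    rw [timeCol, if_pos (by omega)] at hc
    exact sig_le_sigMax hι hx.apply_zero (by omega) hc
  · intro t ht hc
    rw [es]
    rcases lt_or_ge t N with h | h
    · rw [pathSig_timePath hx h, hk.sigMax_eq]
      rw [timeCol, if_pos h] at hc
      exact hk.lt _ (by omega) (by omega) hc
    · rw [pathSig_timePath_virtual hx h, hc]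
      exact h0

lemma runMax_le_sigMax (hι : ∀ i : I, {k : ℕ | 1 ≤ k ∧ ι k = i}.Infinite) {x : ℕ →₀ ℤ} {i : I}
    (hx : SuppIn N x) (h : sig0 A ι lam i x ≤ sigMax A ι i x) (t : ℕ) :
    runMax (timeCol ι N) i (pathSig A (timeCol ι N) (timeShift ι lam N) (timePath N x)) t
      ≤ sigMax A ι i x := by
  refine runMax_le _ (sigMax_nonneg hι hx.apply_zero i) fun s _ hs => ?_
  rcases lt_or_ge s N with hlt | hge
  · rw [pathSig_timePath hx hlt]
    rw [timeCol, if_pos hlt] at hs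
    exact sig_le_sigMax hι hx.apply_zero (by omega) hs
  · rw [pathSig_timePath_virtual hx hge, hs]
    exact h

lemma pitman_eq_self (hι : ∀ i : I, {k : ℕ | 1 ≤ k ∧ ι k = i}.Infinite) {x : ℕ →₀ ℤ} {i : I}
    (hx : SuppIn N x) (h : sig0 A ι lam i x ≤ sigMax A ι i x) (h0 : sigMax A ι i x ≤ 0) :
    pitman A (timeCol ι N) (timeShift ι lam N) i (timePath N x) = timePath N x := by
  have hz : ∀ t, runMax (timeCol ι N) i
      (pathSig A (timeCol ι N) (timeShift ι lam N) (timePath N x)) t = 0 := fun t =>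
    le_antisymm ((runMax_le_sigMax hι hx h t).trans h0) (runMax_nonneg _ _)
  funext t
  rw [pitman, hz, hz]
  ring

lemma sig0_le_sigMax_of_pitman (hι : ∀ i : I, {k : ℕ | 1 ≤ k ∧ ι k = i}.Infinite) {x : ℕ →₀ ℤ}
    {i : I} (hx : SuppIn N x)
    (h : ∀ t, N ≤ t → pitman A (timeCol ι N) (timeShift ι lam N) i (timePath N x) t = 0) :
    sig0 A ι lam i x ≤ sigMax A ι i x := by
  set R := runMax (timeCol ι N) i
    (pathSig A (timeCol ι N) (timeShift ι lam N) (timePath N x)) with hR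
  have hstep : ∀ t, N ≤ t → R (t + 1) = R t := by
    intro t ht
    have := h t ht
    rw [pitman, timePath, if_neg (by omega), ← hR] at this
    linarith
  have hconst : ∀ t, N ≤ t → R t = R N := by
    intro t ht
    induction t, ht using Nat.le_induction with
    | base => rfl
    | succ t ht ih => rw [hstep t ht, ih]
  obtain ⟨k, ⟨hk, hki⟩⟩ := (hι i).nonempty
  have hc : timeCol ι N (N + k - 1) = i := by
    rw [timeCol, if_neg (by omega), show N + k - 1 - N + 1 = k by omega, hki]
  have hle := le_runMax (pathSig A (timeCol ι N) (timeShift ι lam N) (timePath N x)) hc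
    (show N + k - 1 < N + k by omega)
  rw [pathSig_timePath_virtual hx (by omega), hc, ← hR, hconst _ (by omega)] at hle
  rwa [sigMax_eq_runMax (lam := lam) hι hx]

lemma exists_ftil_eq (hA : ∀ i, A i i = 2)
    (hι : ∀ i : I, {k : ℕ | 1 ≤ k ∧ ι k = i}.Infinite) {y : ℕ →₀ ℤ} {i : I}
    (hy : SuppIn N y) (h : sig0 A ι lam i y ≤ sigMax A ι i y) (h0 : 0 < sigMax A ι i y) :
    ∃ x, SuppIn N x ∧ ftil A ι lam i (some x) = some y ∧
      sigMax A ι i x = sigMax A ι i y - 1 ∧ sig0 A ι lam i x ≤ sigMax A ι i x := by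
  classical
  have hmax := sigMax_spec (A := A) hι hy.apply_zero i
  have hbd : ∀ l, sig A ι l y = sigMax A ι i y → l ≤ N := by
    intro l hl
    by_contra hlt
    rw [sig_eq_zero hy (by omega)] at hl
    omega
  have hex : ∃ l ≤ N, 1 ≤ l ∧ ι l = i ∧ sig A ι l y = sigMax A ι i y := by
    obtain ⟨l, ⟨hl, hli⟩, e⟩ := hmax.1
    exact ⟨l, hbd l e, hl, hli, e⟩
  obtain ⟨l₀, hl₀N, hl₀⟩ := hex
  obtain ⟨hk1, hki, hks⟩ := Nat.findGreatest_spec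
    (P := fun l => 1 ≤ l ∧ ι l = i ∧ sig A ι l y = sigMax A ι i y) hl₀N hl₀
  have hkN := Nat.findGreatest_le
    (P := fun l => 1 ≤ l ∧ ι l = i ∧ sig A ι l y = sigMax A ι i y) N
  have hgt := fun l => Nat.findGreatest_is_greatest (k := l) (n := N)
    (P := fun l => 1 ≤ l ∧ ι l = i ∧ sig A ι l y = sigMax A ι i y)
  generalize Nat.findGreatest
    (fun l => 1 ≤ l ∧ ι l = i ∧ sig A ι l y = sigMax A ι i y) N = k at hk1 hki hks hkN hgt
  obtain ⟨x, rfl⟩ : ∃ x, y = x + Finsupp.single k 1 :=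
    ⟨y - Finsupp.single k 1, (sub_add_cancel _ _).symm⟩
  have hsig := sig_add_single (A := A) (ι := ι) x k
  have hx : SuppIn N x := by
    intro l hl
    by_cases hlk : l = k
    · exact hlk ▸ ⟨hk1, hkN⟩
    · exact hy l (by simpa [Finsupp.single_apply, Ne.symm hlk] using hl)
  set M := sigMax A ι i (x + Finsupp.single k 1)
  have hxk : sig A ι k x = M - 1 := by
    have := hsig k
    rw [if_pos rfl, if_neg (by omega)] at this
    omega
  have hfirst : IsFirstMax A ι i x k := by
    have hlt : ∀ l, 1 ≤ l → l < k → ι l = i → sig A ι l x < sig A ι k x := by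
      intro l hl hlk hli
      have h1 := hsig l
      rw [if_neg (by omega), if_pos hlk, hli, hki, hA] at h1
      have h2 := hmax.2 ⟨l, ⟨hl, hli⟩, rfl⟩
      simp only at h2
      omega
    refine ⟨hk1, hki, fun l hl hli => ?_, hlt⟩
    rcases lt_trichotomy l k with hlk | rfl | hlk
    · exact (hlt l hl hlk hli).le
    · exact le_rfl
    · have h1 := hsig l
      rw [if_neg (by omega), if_neg (by omega)] at h1
      have h2 := hmax.2 ⟨l, ⟨hl, hli⟩, rfl⟩
      simp only at h2
      have h3 : sig A ι l (x + Finsupp.single k 1) ≠ M := fun e =>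
        hgt l hlk (hbd l e) ⟨hl, hli, e⟩
      omega
  have hsM : sigMax A ι i x = M - 1 := hfirst.sigMax_eq.trans hxk
  have hs0 := sig0_add_single (A := A) (ι := ι) (lam := lam) x hk1 i
  rw [hki, hA] at hs0
  exact ⟨x, hx, (ftil_eq_some_iff hι hx.apply_zero i).2 ⟨by omega, k, hfirst, rfl⟩, hsM,
    by omega⟩

lemma mem_FSet_of_pitman (hA : ∀ i, A i i = 2)
    (hι : ∀ i : I, {k : ℕ | 1 ≤ k ∧ ι k = i}.Infinite) {v : ℕ →₀ ℤ} {i : I}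
    (hv : v ∈ FSet A ι lam) (hvN : SuppIn N v) (n : ℕ) : ∀ x : ℕ →₀ ℤ, SuppIn N x →
    sig0 A ι lam i x ≤ sigMax A ι i x → sigMax A ι i x ≤ n →
    pitman A (timeCol ι N) (timeShift ι lam N) i (timePath N x) = timePath N v →
    x ∈ FSet A ι lam ∧
      (0 < sigMax A ι i x → ∃ z ∈ FSet A ι lam, ftil A ι lam i (some z) = some x) := by
  induction n with
  | zero =>
    intro x hx h hn hp
    rw [pitman_eq_self hι hx h (by exact_mod_cast hn)] at hp
    rw [timePath_injective hx hvN hp] at hn ⊢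
    exact ⟨hv, fun h => by push_cast at hn; omega⟩
  | succ n ih =>
    intro x hx h hn hp
    rcases le_or_gt (sigMax A ι i x) 0 with h0 | h0
    · rw [pitman_eq_self hι hx h h0] at hp
      rw [timePath_injective hx hvN hp] at h0 ⊢
      exact ⟨hv, fun h => by omega⟩
    · obtain ⟨z, hz, hf, hm, hl⟩ := exists_ftil_eq hA hι hx h h0
      have hzF := (ih z hz hl (by push_cast at hn; omega)
        ((pitman_eq_of_ftil hA hι hz hx hf).symm.trans hp)).1
      exact ⟨FSet_of_ftil hzF hf, fun _ => ⟨z, hzF, hf⟩⟩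

/-- `φ_i(x) ≥ 0`-type condition together with the existence of `ẽ_i x` inside `F(λ)`. -/
def UpperNormal (A : I → I → ℤ) (ι : ℕ → I) (lam : I → ℤ) (i : I) (x : ℕ →₀ ℤ) : Prop :=
  sig0 A ι lam i x ≤ sigMax A ι i x ∧
    (0 < sigMax A ι i x → ∃ z ∈ FSet A ι lam, ftil A ι lam i (some z) = some x)

lemma exists_timePath_eq_pitman (hA : ∀ i, A i i = 2)
    (hι : ∀ i : I, {k : ℕ | 1 ≤ k ∧ ι k = i}.Infinite) {d : ℤ}
    (hreg : ∀ w ∈ FSet A ι lam, w.degree ≤ d → ∀ i, UpperNormal A ι lam i w) (i : I) (n : ℕ) :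
    ∀ w ∈ FSet A ι lam, w.degree ≤ n → w.degree ≤ d → SuppIn N w →
    ∃ v ∈ FSet A ι lam, v.degree ≤ d ∧ SuppIn N v ∧
      timePath N v = pitman A (timeCol ι N) (timeShift ι lam N) i (timePath N w) := by
  induction n with
  | zero =>
    intro w hw hn hd hN
    obtain ⟨h1, h2⟩ := hreg w hw hd i
    refine ⟨w, hw, hd, hN, (pitman_eq_self hι hN h1 (not_lt.1 fun h0 => ?_)).symm⟩
    obtain ⟨z, hz, hf⟩ := h2 h0
    have hz0 := FSet_nonneg hι z hz
    have := degree_ftil hι hz0.1 hf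
    have := degree_nonneg hz0.2
    push_cast at hn
    omega
  | succ n ih =>
    intro w hw hn hd hN
    obtain ⟨h1, h2⟩ := hreg w hw hd i
    rcases le_or_gt (sigMax A ι i w) 0 with h0 | h0
    · exact ⟨w, hw, hd, hN, (pitman_eq_self hι hN h1 h0).symm⟩
    · obtain ⟨z, hz, hf⟩ := h2 h0
      have hz0 := FSet_nonneg hι z hz
      have hdeg := degree_ftil hι hz0.1 hf
      have hzN := hN.of_le hz0.2 (le_ftil hι hz0.1 hf)
      rw [pitman_eq_of_ftil hA hι hzN hN hf]
      push_cast at hn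
      exact ih z hz (by omega) (by omega) hzN

lemma exists_timePath_eq_pitChain (hA : ∀ i, A i i = 2)
    (hι : ∀ i : I, {k : ℕ | 1 ≤ k ∧ ι k = i}.Infinite) {d : ℤ}
    (hreg : ∀ w ∈ FSet A ι lam, w.degree ≤ d → ∀ i, UpperNormal A ι lam i w) (n : ℕ) :
    ∀ i j : I, ∀ w ∈ FSet A ι lam, w.degree ≤ d → SuppIn N w →
    ∃ v ∈ FSet A ι lam, SuppIn N v ∧
      timePath N v = pitChain A (timeCol ι N) (timeShift ι lam N) n i j (timePath N w) := by
  induction n with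
  | zero => intro i j w hw _ hN; exact ⟨w, hw, hN, rfl⟩
  | succ n ih =>
    intro i j w hw hd hN
    obtain ⟨v, hv, hvd, hvN, e⟩ := exists_timePath_eq_pitman hA hι hreg i w.degree.toNat w hw
      (Int.self_le_toNat _) hd hN
    obtain ⟨u, hu, huN, e'⟩ := ih j i v hv hvd hvN
    exact ⟨u, hu, huN, by rw [e', e]; rfl⟩

lemma mem_FSet_of_pitChain (hA : ∀ i, A i i = 2)
    (hι : ∀ i : I, {k : ℕ | 1 ≤ k ∧ ι k = i}.Infinite) {v : ℕ →₀ ℤ}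
    (hv : v ∈ FSet A ι lam) (hvN : SuppIn N v) (n : ℕ) : ∀ (i j : I) (x : ℕ →₀ ℤ), SuppIn N x →
    pitChain A (timeCol ι N) (timeShift ι lam N) n i j (timePath N x) = timePath N v →
    x ∈ FSet A ι lam ∧ (1 ≤ n → UpperNormal A ι lam i x) := by
  induction n with
  | zero =>
    intro i j x hx h
    exact ⟨timePath_injective hx hvN h ▸ hv, fun h => absurd h (by norm_num)⟩
  | succ n ih =>
    intro i j x hx h
    set y := pitman A (timeCol ι N) (timeShift ι lam N) i (timePath N x) with hy
    have hzero : ∀ t, N ≤ t → y t = 0 := by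
      intro t ht
      have h1 : y t ≤ timePath N x t := pitman_le i _ t
      have h2 : pitChain A (timeCol ι N) (timeShift ι lam N) n j i y t ≤ y t :=
        pitChain_antitone (A := A) (col := timeCol ι N) (C := timeShift ι lam N) j i y t
          (Nat.zero_le n)
      have h3 := congrFun h t
      rw [pitChain, ← hy] at h3
      rw [timePath, if_neg (by omega)] at h1 h3
      omega
    obtain ⟨z, hz, e⟩ := exists_timePath_eq hzero
    have hzF : z ∈ FSet A ι lam := (ih j i z hz (by rw [e]; exact h)).1
    have hl := sig0_le_sigMax_of_pitman hι hx hzero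
    have := mem_FSet_of_pitman hA hι hzF hz (sigMax A ι i x).toNat x hx hl
      (Int.self_le_toNat _) (hy.symm.trans e.symm)
    exact ⟨this.1, fun _ => ⟨hl, this.2⟩⟩

lemma exists_eq_add_two (g : ℕ → ℕ → ℤ) (hanti : ∀ t, Antitone fun n => g n t)
    (hpos : ∀ n t, 0 ≤ g n t) (hzero : ∀ n t, N ≤ t → g n t = 0) :
    ∃ n, 1 ≤ n ∧ g n = g (n + 2) := by
  by_contra! H
  set S : ℕ → ℤ := fun n => ∑ t ∈ Finset.range N, g n t with hS
  have hstep : ∀ n, 1 ≤ n → S (n + 2) < S n := by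
    intro n hn
    obtain ⟨t, ht⟩ := Function.ne_iff.1 (H n hn)
    have htN : t < N := by
      by_contra h
      exact ht ((hzero n t (by omega)).trans (hzero (n + 2) t (by omega)).symm)
    exact Finset.sum_lt_sum (fun s _ => hanti s (by omega))
      ⟨t, Finset.mem_range.2 htN, lt_of_le_of_ne (hanti t (by omega)) ht.symm⟩
  have hdesc : ∀ k : ℕ, S (1 + 2 * k) ≤ S 1 - k := by
    intro k
    induction k with
    | zero => simp
    | succ k ih =>
      have := hstep (1 + 2 * k) (by omega)
      rw [show 1 + 2 * (k + 1) = 1 + 2 * k + 2 by ring]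
      push_cast
      omega
  have h1 := hdesc ((S 1).toNat + 1)
  have h2 : 0 ≤ S (1 + 2 * ((S 1).toNat + 1)) := Finset.sum_nonneg fun t _ => hpos _ t
  have h3 := Int.self_le_toNat (S 1)
  push_cast at h1
  omega

lemma upperNormal_of_mem (hA : ∀ i, A i i = 2) (hAoff : ∀ i j, i ≠ j → A i j ≤ 0)
    (hAzero : ∀ i j, A i j = 0 ↔ A j i = 0)
    (hι : ∀ i : I, {k : ℕ | 1 ≤ k ∧ ι k = i}.Infinite) (hlam : ∀ i, 0 ≤ lam i) (d : ℕ) :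
    ∀ x ∈ FSet A ι lam, x.degree ≤ d → ∀ i, UpperNormal A ι lam i x := by
  have hzero : ∀ i, UpperNormal A ι lam i 0 := by
    intro i
    have h0 : sigMax A ι i 0 = 0 := by
      refine IsGreatest.csSup_eq ⟨?_, ?_⟩
      · obtain ⟨k, hk⟩ := (hι i).nonempty
        exact ⟨k, hk, by simp [sig]⟩
      · rintro _ ⟨k, -, rfl⟩
        simp [sig]
    refine ⟨?_, fun h => absurd h (by rw [h0]; exact lt_irrefl _)⟩
    rw [h0]
    simpa [sig0] using hlam i
  have hcases : ∀ x ∈ FSet A ι lam,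
      x = 0 ∨ ∃ y ∈ FSet A ι lam, ∃ j, ftil A ι lam j (some y) = some x :=
    FSet_induction (Or.inl rfl) fun y x j hy _ hf => Or.inr ⟨y, hy, j, hf⟩
  induction d with
  | zero =>
    intro x hx hd i
    rcases hcases x hx with rfl | ⟨y, hy, j, hf⟩
    · exact hzero i
    · have hy0 := FSet_nonneg hι y hy
      have := degree_ftil hι hy0.1 hf
      have := degree_nonneg hy0.2
      push_cast at hd
      omega
  | succ d ih =>
    intro x hx hd i
    rcases hcases x hx with rfl | ⟨y, hy, j, hf⟩
    · exact hzero i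
    have hy0 := FSet_nonneg hι y hy
    have hx0 := FSet_nonneg hι x hx
    have hdeg := degree_ftil hι hy0.1 hf
    push_cast at hd
    have hyd : y.degree ≤ d := by omega
    by_cases hij : i = j
    · subst hij
      refine ⟨?_, fun _ => ⟨y, hy, hf⟩⟩
      obtain ⟨hlt, k, hk, rfl⟩ := (ftil_eq_some_iff hι hy0.1 i).1 hf
      have h1 := sig0_add_single (A := A) (ι := ι) (lam := lam) y hk.one_le i
      have h2 := sig_add_single (A := A) (ι := ι) y k k
      have h3 := sig_le_sigMax (A := A) hι hx0.1 hk.one_le hk.col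
      rw [hk.col, hA] at h1
      rw [if_pos rfl, if_neg (lt_irrefl k), ← hk.sigMax_eq] at h2
      omega
    · obtain ⟨N, hxN⟩ := exists_suppIn hx0.1
      have hyN := hxN.of_le hy0.2 (le_ftil hι hy0.1 hf)
      have hxy : ∀ n, 1 ≤ n →
          pitChain A (timeCol ι N) (timeShift ι lam N) n j i (timePath N x)
            = pitChain A (timeCol ι N) (timeShift ι lam N) n j i (timePath N y) := by
        intro n hn
        obtain ⟨n, rfl⟩ : ∃ m, n = m + 1 := ⟨n - 1, by omega⟩
        rw [pitChain, pitChain, pitman_eq_of_ftil hA hι hyN hxN hf]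
      have hch := fun n => exists_timePath_eq_pitChain (N := N) hA hι ih n j i y hy hyd hyN
      have hstab := exists_eq_add_two (N := N)
        (fun n => pitChain A (timeCol ι N) (timeShift ι lam N) n j i (timePath N y))
        (fun t => pitChain_antitone j i _ t)
        (fun n t => by
          obtain ⟨v, hv, -, e⟩ := hch n
          simp only [← e, timePath]
          split_ifs
          · exact (FSet_nonneg hι v hv).2 _
          · exact le_rfl)
        (fun n t ht => by
          obtain ⟨v, -, -, e⟩ := hch n
          simp only [← e, timePath]
          rw [if_neg (by omega)])
      obtain ⟨n, m, hn, hm, e⟩ := pitChain_confluent (C := timeShift ι lam N) hA hAoff hAzero hij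
        (timePath N x) (by
          obtain ⟨n, hn, e⟩ := hstab
          exact ⟨n, hn, by rw [hxy n hn, hxy (n + 2) (by omega)]; exact e⟩)
      obtain ⟨v, hv, hvN, e'⟩ := hch m
      exact (mem_FSet_of_pitChain hA hι hv hvN n i j x hxN
        (by rw [e, hxy m hm, e'])).2 hn

lemma sig_last {L : ℕ} {x : ℕ →₀ ℤ} (hx : ∀ k, L < k → x k = 0) : sig A ι L x = x L := by
  rw [sig, Finset.sum_eq_zero, add_zero]
  intro j hj
  rw [hx j (Finset.mem_filter.1 hj).2, mul_zero]

lemma Dem_subset (hι : ∀ i : I, {k : ℕ | 1 ≤ k ∧ ι k = i}.Infinite) (L : ℕ) :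
    Dem A ι lam L ⊆ {x ∈ FSet A ι lam | ∀ k, L < k → x k = 0} := by
  induction L with
  | zero =>
    rintro x rfl
    exact ⟨zero_mem_FSet, fun _ _ => rfl⟩
  | succ L ih =>
    rintro y ⟨m, x, hx, h⟩
    induction m generalizing y with
    | zero =>
      obtain rfl := Option.some.inj h
      exact ⟨(ih hx).1, fun k hk => (ih hx).2 k (by omega)⟩
    | succ m ihm =>
      rw [Function.iterate_succ_apply'] at h
      cases hz : (ftil A ι lam (ι (L + 1)))^[m] (some x) with
      | none => rw [hz] at h; exact absurd h (by simp [ftil])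
      | some z =>
        rw [hz] at h
        obtain ⟨hzF, hzL⟩ := ihm hz
        refine ⟨FSet_of_ftil hzF h, fun k hk => ?_⟩
        have hz0 := FSet_nonneg hι z hzF
        obtain ⟨-, l, hl, rfl⟩ := (ftil_eq_some_iff hι hz0.1 _).1 h
        have hlL : l ≤ L + 1 := by
          by_contra hlt
          have h1 := hl.lt (L + 1) (by omega) (by omega) rfl
          rw [sig_last hzL, sig_last (fun k hk => hzL k (by omega)), hzL l (by omega)] at h1
          exact absurd (hz0.2 (L + 1)) (by omega)
        rw [Finsupp.add_apply, hzL k hk, Finsupp.single_apply, if_neg (by omega), add_zero]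

lemma exists_iterate_ftil (hι : ∀ i : I, {k : ℕ | 1 ≤ k ∧ ι k = i}.Infinite)
    (hnorm : ∀ x ∈ FSet A ι lam, ∀ i, UpperNormal A ι lam i x) (i : I) (n : ℕ) :
    ∀ x ∈ FSet A ι lam, x.degree ≤ n → ∃ m, ∃ y ∈ FSet A ι lam, (∀ k, y k ≤ x k) ∧
      sigMax A ι i y ≤ 0 ∧ (ftil A ι lam i)^[m] (some y) = some x := by
  induction n with
  | zero =>
    intro x hx hn
    refine ⟨0, x, hx, fun _ => le_rfl, not_lt.1 fun h0 => ?_, rfl⟩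
    obtain ⟨z, hz, hf⟩ := (hnorm x hx i).2 h0
    have hz0 := FSet_nonneg hι z hz
    have := degree_ftil hι hz0.1 hf
    have := degree_nonneg hz0.2
    push_cast at hn
    omega
  | succ n ih =>
    intro x hx hn
    rcases le_or_gt (sigMax A ι i x) 0 with h0 | h0
    · exact ⟨0, x, hx, fun _ => le_rfl, h0, rfl⟩
    · obtain ⟨z, hz, hf⟩ := (hnorm x hx i).2 h0
      have hz0 := FSet_nonneg hι z hz
      have hdeg := degree_ftil hι hz0.1 hf
      push_cast at hn
      obtain ⟨m, y, hy, hyz, hy0, e⟩ := ih z hz (by omega)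
      exact ⟨m + 1, y, hy, fun k => (hyz k).trans (le_ftil hι hz0.1 hf k), hy0, by
        rw [Function.iterate_succ_apply', e, hf]⟩

lemma subset_Dem (hι : ∀ i : I, {k : ℕ | 1 ≤ k ∧ ι k = i}.Infinite)
    (hnorm : ∀ x ∈ FSet A ι lam, ∀ i, UpperNormal A ι lam i x) (L : ℕ) :
    {x ∈ FSet A ι lam | ∀ k, L < k → x k = 0} ⊆ Dem A ι lam L := by
  induction L with
  | zero =>
    rintro x ⟨hx, h⟩
    refine Finsupp.ext fun k => ?_
    rcases Nat.eq_zero_or_pos k with rfl | hk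
    · exact (FSet_nonneg hι x hx).1
    · exact h k hk
  | succ L ih =>
    rintro x ⟨hx, h⟩
    obtain ⟨m, y, hy, hyx, hy0, e⟩ := exists_iterate_ftil hι hnorm (ι (L + 1)) x.degree.toNat x hx
      (Int.self_le_toNat _)
    have hyn := FSet_nonneg hι y hy
    have hyL : ∀ k, L + 1 < k → y k = 0 := fun k hk =>
      le_antisymm ((hyx k).trans (h k hk).le) (hyn.2 k)
    refine ⟨m, y, ih ⟨hy, fun k hk => ?_⟩, e⟩
    rcases eq_or_lt_of_le (Nat.succ_le_of_lt hk) with rfl | hk'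
    · have h1 := sig_le_sigMax (A := A) hι hyn.1 (show 1 ≤ L + 1 by omega) rfl
      rw [sig_last hyL] at h1
      exact le_antisymm (h1.trans hy0) (hyn.2 _)
    · exact hyL k hk'

end Embedding

/-- Let `w = s_{i_L} ⋯ s_{i_1}` be a reduced word in the Weyl group of the
symmetrizable generalized Cartan matrix `A`, whose letters `i_1, …, i_L` are the first `L`
terms of `ι`.  Then the Demazure subset `D_L ⊂ ℤ^∞_ι[λ]` equals
`{ x ∈ F(λ) : x_k = 0 for all k > L }`. -/
theorem demazure_polytope {I : Type*} [Fintype I] [DecidableEq I]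
    (A : I → I → ℤ)
    (hAdiag : ∀ i, A i i = 2)
    (hAoff : ∀ i j, i ≠ j → A i j ≤ 0)
    (hAzero : ∀ i j, A i j = 0 ↔ A j i = 0)
    (hAsym : ∃ d : I → ℤ, (∀ i, 0 < d i) ∧ ∀ i j, d i * A i j = d j * A j i)
    (ι : ℕ → I)
    (hι₁ : ∀ k, 1 ≤ k → ι k ≠ ι (k + 1))
    (hι₂ : ∀ i : I, {k : ℕ | 1 ≤ k ∧ ι k = i}.Infinite)
    (lam : I → ℤ) (hlam : ∀ i, 0 ≤ lam i)
    (L : ℕ)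
    (hred : (coxOf A).toCoxeterSystem.IsReduced (demWord ι L)) :
    Dem A ι lam L = {x ∈ FSet A ι lam | ∀ k, L < k → x k = 0} := by
  have hnorm : ∀ x ∈ FSet A ι lam, ∀ i, UpperNormal A ι lam i x := fun x hx =>
    upperNormal_of_mem hAdiag hAoff hAzero hι₂ hlam x.degree.toNat x hx (Int.self_le_toNat _)
  exact (Dem_subset hι₂ L).antisymm (subset_Dem hι₂ hnorm L)

end PaperNakashima
end
end

section
/- Let L ≥ 1 and let x ∈ ℤ^∞ have all entries nonnegative and satisfy x_k = 0 for all k > L. Then, in the crystal ℤ^∞_ι[λ], if f̃_{i_L}(x) ≠ 0 then every entry of f̃_{i_L}(x) at a position k > L is 0; in particular min M^{(i_L)}(x) ≤ L. -/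
noncomputable section

namespace PaperNakashima

variable {I : Type*} [DecidableEq I]

/-- If `x` vanishes above `L`, then `σ_k(x) = x_k` for all `k ≥ L`. -/
theorem sig_eq_apply_of_le {I : Type*} (A : I → I → ℤ) (ι : ℕ → I) {L k : ℕ} {x : ℕ →₀ ℤ}
    (hxL : ∀ k, L < k → x k = 0) (hk : L ≤ k) : sig A ι k x = x k := by
  rw [sig, Finset.sum_eq_zero, add_zero]
  intro j hj
  rw [hxL j (hk.trans_lt (Finset.mem_filter.mp hj).2), mul_zero]

/-- The values `σ_k(x)` are bounded above. -/
theorem bddAbove_range_sig {I : Type*} (A : I → I → ℤ) (ι : ℕ → I) {L : ℕ} {x : ℕ →₀ ℤ}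
    (hxL : ∀ k, L < k → x k = 0) : BddAbove (Set.range fun k => sig A ι k x) := by
  refine Set.Finite.bddAbove
    ((((Set.finite_Iic L).image fun k => sig A ι k x).insert 0).subset ?_)
  rintro _ ⟨k, rfl⟩
  rcases le_or_gt k L with hk | hk
  · exact Or.inr ⟨k, hk, rfl⟩
  · exact Or.inl ((sig_eq_apply_of_le A ι hxL hk.le).trans (hxL k hk))

/-- If `x` vanishes above `L ≥ 1` and `x_L ≥ 0`, then `min M^{(i_L)}(x) ≤ L`. -/
theorem sInf_Mset_le {I : Type*} (A : I → I → ℤ) (ι : ℕ → I) {L : ℕ} (hL : 1 ≤ L)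
    {x : ℕ →₀ ℤ} (hx : 0 ≤ x L) (hxL : ∀ k, L < k → x k = 0) :
    sInf (Mset A ι (ι L) x) ≤ L := by
  rcases (Mset A ι (ι L) x).eq_empty_or_nonempty with h | h
  · simp [h]
  obtain ⟨-, -, hm⟩ := Nat.sInf_mem h
  by_contra! hlt
  have hle : sig A ι L x ≤ sigMax A ι (ι L) x :=
    le_csSup ((bddAbove_range_sig A ι hxL).mono (Set.image_subset_range _ _))
      ⟨L, ⟨hL, rfl⟩, rfl⟩
  have hge : sigMax A ι (ι L) x ≤ sig A ι L x := by
    rw [← hm, sig_eq_apply_of_le A ι hxL hlt.le, hxL _ hlt, sig_eq_apply_of_le A ι hxL le_rfl]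
    exact hx
  exact hlt.not_ge (Nat.sInf_le ⟨hL, rfl, hle.antisymm hge⟩)

/-- If `x ∈ ℤ^∞` has nonnegative entries and `x_k = 0` for `k > L` (`L ≥ 1`),
then whenever `f̃_{i_L}(x) ≠ 0`, all entries of `f̃_{i_L}(x)` in positions `k > L` vanish;
in particular `min M^{(i_L)}(x) ≤ L`. -/
theorem ftil_preserves_truncation {I : Type*} [Fintype I] [DecidableEq I]
    (A : I → I → ℤ)
    (hAdiag : ∀ i, A i i = 2)
    (hAoff : ∀ i j, i ≠ j → A i j ≤ 0)
    (hAzero : ∀ i j, A i j = 0 ↔ A j i = 0)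
    (hAsym : ∃ d : I → ℤ, (∀ i, 0 < d i) ∧ ∀ i j, d i * A i j = d j * A j i)
    (ι : ℕ → I)
    (hι₁ : ∀ k, 1 ≤ k → ι k ≠ ι (k + 1))
    (hι₂ : ∀ i : I, {k : ℕ | 1 ≤ k ∧ ι k = i}.Infinite)
    (lam : I → ℤ) (hlam : ∀ i, 0 ≤ lam i)
    (L : ℕ) (hL : 1 ≤ L)
    (x : ℕ →₀ ℤ) (hx0 : x 0 = 0) (hxnn : ∀ k, 0 ≤ x k) (hxL : ∀ k, L < k → x k = 0) :
    ∀ y : ℕ →₀ ℤ, ftil A ι lam (ι L) (some x) = some y →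
      (∀ k, L < k → y k = 0) ∧ sInf (Mset A ι (ι L) x) ≤ L := by
  intro y hy
  have hM := sInf_Mset_le A ι hL (hxnn L) hxL
  refine ⟨fun k hk => ?_, hM⟩
  simp only [ftil, Option.ite_none_right_eq_some, Option.some.injEq] at hy
  rw [← hy.2, Finsupp.add_apply, hxL k hk, Finsupp.single_eq_of_ne (hM.trans_lt hk).ne', add_zero]

end PaperNakashima
end
end
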